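/- There exists a finite mixed dynamic causal graph D with static confounders (directed edges within a slice or to the next slice, bidirected edges within slices), together with sets of vertices X ⊆ V_{t_x} and Y ⊆ V_{t_y} with t_x + 1 < t_y, such that D contains no hedge for P(Y|do(X)), yet D contains a hedge for P(V_{t_x+1}|do(X)) — i.e., there exist two R-rooted C-forests F' ⊆ F with F ∩ X ≠ ∅ and F' ∩ X = ∅ whose common root R consists of ancestors of V_{t_x+1} in D_X̄ but not of ancestors of Y in D_X̄. -/

import Mathlib

/-! STATEMENT 7: There exists a finite mixed dynamic causal graph `D` with static
confounders, together with `X ⊆ V_{t_x}` and `Y ⊆ V_{t_y}`, `t_x + 1 < t_y`, such that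
`D` contains no hedge for `P(Y|do(X))`, yet `D` contains a hedge for
`P(V_{t_x+1}|do(X))` — two `R`-rooted C-forests `F' ⊆ F` with `F ∩ X ≠ ∅`,
`F' ∩ X = ∅`, whose common root `R` consists of ancestors of `V_{t_x+1}` in `D_X̄` but
not of ancestors of `Y` in `D_X̄`. -/

/-- The time timeSlice `V_t = {t} × V`. -/
def timeSlice {V : Type*} (t : ℤ) : Set (ℤ × V) := {p | p.1 = t}

/-- `S` is bidirected-connected: any two of its elements are joined by a path of
bidirected edges all of whose vertices lie in `S`. -/
def BConnected {V : Type*} (B : ℤ × V → ℤ × V → Prop) (S : Set (ℤ × V)) : Prop :=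
  ∀ a ∈ S, ∀ b ∈ S,
    Relation.ReflTransGen (fun u v : ℤ × V => B u v ∧ u ∈ S ∧ v ∈ S) a b

/-- A C-forest: a bidirected-connected set of vertices in which every vertex has at most
one child (w.r.t. the directed edges) inside the set. -/
def CForest {V : Type*} (D B : ℤ × V → ℤ × V → Prop) (F : Set (ℤ × V)) : Prop :=
  BConnected B F ∧
    ∀ v ∈ F, ∀ c₁ ∈ F, ∀ c₂ ∈ F, D v c₁ → D v c₂ → c₁ = c₂

/-- The root of a C-forest: its vertices with no child inside the set. -/
def root {V : Type*} (D : ℤ × V → ℤ × V → Prop) (F : Set (ℤ × V)) : Set (ℤ × V) :=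
  {v | v ∈ F ∧ ∀ c ∈ F, ¬ D v c}

/-- `u` is an ancestor of `w`: there is a (possibly empty) directed path from `u` to `w`. -/
def ancestor {V : Type*} (D : ℤ × V → ℤ × V → Prop) (u w : ℤ × V) : Prop :=
  Relation.ReflTransGen D u w

/-- The graph `D_X̄`: delete all directed edges whose head lies in `X`. -/
def delEdgesInto {V : Type*} (D : ℤ × V → ℤ × V → Prop) (X : Set (ℤ × V)) :
    ℤ × V → ℤ × V → Prop :=
  fun a b => D a b ∧ b ∉ X

/-- `F' ⊆ F` form a hedge for `P(Z|do(X))`: both are C-forests with the same root `R`,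
`F ∩ X ≠ ∅`, `F' ∩ X = ∅`, and every vertex of `R` is an ancestor of some vertex of `Z`
in `D_X̄`. -/
def Hedge {V : Type*} (D B : ℤ × V → ℤ × V → Prop) (X Z F' F : Set (ℤ × V)) : Prop :=
  CForest D B F ∧ CForest D B F' ∧ F' ⊆ F ∧
  root D F' = root D F ∧
  (F ∩ X).Nonempty ∧ F' ∩ X = ∅ ∧
  ∀ r ∈ root D F, ∃ z ∈ Z, ancestor (delEdgesInto D X) r z

/-- Causal edges of the witness, with metavariables `0` (treatment), `1` and `2`: in each slice
`0` points to `1` and `2`, and each of `1`, `2` points to itself in the next slice. -/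
def forkEdge (a b : ℤ × Fin 3) : Prop :=
  (a.2 = 0 ∧ b.2 ≠ 0 ∧ b.1 = a.1) ∨ (a.2 ≠ 0 ∧ b.2 = a.2 ∧ b.1 = a.1 + 1)

/-- Confounders of the witness: `0` and `1` are confounded within each slice. -/
def forkConfounder (a b : ℤ × Fin 3) : Prop :=
  a.1 = b.1 ∧ ((a.2 = 0 ∧ b.2 = 1) ∨ (a.2 = 1 ∧ b.2 = 0))

theorem not_forkEdge_zero {a b : ℤ × Fin 3} (hb : b.2 = 0) : ¬ forkEdge a b := by
  rintro (⟨-, h, -⟩ | ⟨ha, h, -⟩)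
  · exact h hb
  · exact ha (h.symm.trans hb)

theorem not_forkEdge_one_same_slice {a b : ℤ × Fin 3} (ha : a.2 = 1) (hb : b.1 = a.1) :
    ¬ forkEdge a b := by
  rintro (⟨h, -⟩ | ⟨-, -, h⟩)
  · simp [ha] at h
  · omega

theorem forkEdge_ancestor_snd {X : Set (ℤ × Fin 3)} {a b : ℤ × Fin 3}
    (h : ancestor (delEdgesInto forkEdge X) a b) (ha : a.2 = 1) : b.2 = 1 := by
  induction h with
  | refl => exact ha
  | tail _ hbc ih =>
    rcases hbc.1 with ⟨h, -⟩ | ⟨-, h, -⟩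
    · simp [ih] at h
    · exact h.trans ih

theorem subset_of_bConnected_forkConfounder {F : Set (ℤ × Fin 3)} (hF : BConnected forkConfounder F)
    {t : ℤ} (ht : (t, 0) ∈ F) : F ⊆ {(t, 0), (t, 1)} := by
  intro a ha
  induction hF _ ht a ha with
  | refl => simp
  | @tail b c _ hbc ih =>
    obtain ⟨⟨h₁, h₂⟩, hb, hc⟩ := hbc
    obtain ⟨c₁, c₂⟩ := c
    rcases ih hb with rfl | rfl <;> simp_all

theorem bConnected_forkConfounder_pair (t : ℤ) :
    BConnected forkConfounder {(t, 0), (t, 1)} := by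
  rintro a (rfl | rfl) b (rfl | rfl)
  · exact .refl
  · exact .single (by simp [forkConfounder])
  · exact .single (by simp [forkConfounder])
  · exact .refl

theorem root_forkEdge_singleton (t : ℤ) : root forkEdge {(t, 1)} = {(t, 1)} := by
  ext a
  simp only [root, Set.mem_ofPred_eq, Set.mem_singleton_iff, forall_eq, and_iff_left_iff_imp]
  rintro rfl
  exact not_forkEdge_one_same_slice rfl rfl

theorem root_forkEdge_pair (t : ℤ) : root forkEdge {(t, 0), (t, 1)} = {(t, 1)} := by
  ext a
  constructor
  · rintro ⟨rfl | h, hc⟩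
    · exact absurd (.inl ⟨rfl, by simp, rfl⟩) (hc (t, 1) (by simp))
    · exact h
  · rintro rfl
    refine ⟨by simp, ?_⟩
    rintro c (rfl | rfl) <;> exact not_forkEdge_one_same_slice rfl rfl

theorem hedge_fork :
    Hedge forkEdge forkConfounder {(0, 0)} (timeSlice 1) {(0, 1)} {(0, 0), (0, 1)} := by
  refine ⟨⟨bConnected_forkConfounder_pair 0, ?_⟩, ⟨?_, ?_⟩, by simp, ?_, ⟨(0, 0), by simp⟩,
    by simp, ?_⟩
  · rintro v - c₁ (rfl | rfl) c₂ (rfl | rfl) h₁ h₂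
    · rfl
    · exact absurd h₁ (not_forkEdge_zero rfl)
    · exact absurd h₂ (not_forkEdge_zero rfl)
    · rfl
  · rintro a rfl b rfl
    exact .refl
  · rintro v - c₁ rfl c₂ rfl - -
    rfl
  · rw [root_forkEdge_singleton, root_forkEdge_pair]
  · rw [root_forkEdge_pair]
    rintro r rfl
    exact ⟨(1, 1), rfl, .single ⟨.inr (by simp), by simp⟩⟩

theorem not_hedge_fork (F' F : Set (ℤ × Fin 3)) :
    ¬ Hedge forkEdge forkConfounder {(0, 0)} {(2, 2)} F' F := by
  rintro ⟨⟨hF, -⟩, -, -, hroot, ⟨x, hxF, rfl⟩, hdisj, hanc⟩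
  have hsub := subset_of_bConnected_forkConfounder hF hxF
  by_cases h1 : ((0, 1) : ℤ × Fin 3) ∈ F
  · obtain rfl : F = {(0, 0), (0, 1)} :=
      hsub.antisymm (by rintro a (rfl | rfl) <;> assumption)
    obtain ⟨z, rfl, hz⟩ := hanc (0, 1) (by simp [root_forkEdge_pair])
    exact absurd (forkEdge_ancestor_snd hz rfl) (by simp)
  · have hmem : ((0, 0) : ℤ × Fin 3) ∈ root forkEdge F := by
      refine ⟨hxF, fun c hc => ?_⟩
      rcases hsub hc with rfl | rfl
      · exact not_forkEdge_zero rfl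
      · exact absurd hc h1
    rw [← hroot] at hmem
    exact (Set.eq_empty_iff_forall_notMem.mp hdisj) _ ⟨hmem.1, rfl⟩

theorem dcn_id_not_complete :
    ∃ (V : Type) (_ : Fintype V) (D B : ℤ × V → ℤ × V → Prop)
      (tx ty : ℤ) (X Y : Set (ℤ × V)),
      (∀ a b : ℤ × V, D a b → b.1 = a.1 ∨ b.1 = a.1 + 1) ∧
      (∀ a b : ℤ × V, B a b → B b a) ∧
      (∀ a : ℤ × V, ¬ B a a) ∧
      (∀ a b : ℤ × V, B a b → a.1 = b.1) ∧
      tx + 1 < ty ∧ X ⊆ timeSlice tx ∧ Y ⊆ timeSlice ty ∧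
      (¬ ∃ F' F : Set (ℤ × V), Hedge D B X Y F' F) ∧
      (∃ F' F : Set (ℤ × V), Hedge D B X (timeSlice (tx + 1)) F' F ∧
        ∀ r ∈ root D F, ¬ ∃ y ∈ Y, ancestor (delEdgesInto D X) r y) := by
  refine ⟨Fin 3, inferInstance, forkEdge, forkConfounder, 0, 2, {(0, 0)}, {(2, 2)}, ?_, ?_, ?_, ?_,
    by norm_num, by simp [timeSlice], by simp [timeSlice],
    fun ⟨F', F, h⟩ => not_hedge_fork F' F h, {(0, 1)}, {(0, 0), (0, 1)}, hedge_fork, ?_⟩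
  · rintro a b (h | h)
    · exact .inl h.2.2
    · exact .inr h.2.2
  · rintro a b ⟨h, h' | h'⟩
    · exact ⟨h.symm, .inr h'.symm⟩
    · exact ⟨h.symm, .inl h'.symm⟩
  · rintro a ⟨-, h | h⟩ <;> simp [h.1] at h
  · exact fun a b h => h.1
  · rw [root_forkEdge_pair]
    rintro r rfl ⟨y, rfl, hy⟩
    exact absurd (forkEdge_ancestor_snd hy rfl) (by simp)
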